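/- Let N and K be integers with N > K ≥ 2, let δ ∈ (0,1), and let M be a real number with M ≥ 12.3·K·log(N/δ). Then there exist real numbers t₁, t₂ ∈ (0,1) such that (N−K)·exp(−(M/K)·H1(t₁;0,K)) + K·exp(−(M/K)·H2(t₂;0,K)) ≤ δ, where H1(t;0,K) = −K·log(1 + ∑_{n even, n≥2} C(t,n)/(n(K−1)+1)) with C(t,n) = (∏_{l=0}^{n−1}(t−l))/n!, and H2(t;0,K) = −K·log A(t,K) with A(t,K) = 1 + ∑_{n even, n≥2} D(t,n)/(n(K−1)+1) − ∑_{n odd, n≥1} D(t,n)/((n+1)(K−1)+1) and D(t,n) = (∏_{l=0}^{n−1}(t+l))/n!. -/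

import Mathlib

/-- The generalized binomial coefficient `C(t,n) = (∏_{l=0}^{n−1}(t−l))/n!`. -/
noncomputable def genC (t : ℝ) (n : ℕ) : ℝ :=
  (∏ l ∈ Finset.range n, (t - l)) / (n.factorial : ℝ)

/-- `D(t,n) = (∏_{l=0}^{n−1}(t+l))/n!`. -/
noncomputable def genD (t : ℝ) (n : ℕ) : ℝ :=
  (∏ l ∈ Finset.range n, (t + l)) / (n.factorial : ℝ)

/-- `H1(t;0,K) = −K·log(1 + ∑_{n even, n≥2} C(t,n)/(n(K−1)+1))`. -/
noncomputable def H1zero (t K : ℝ) : ℝ :=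
  -K * Real.log
    (1 + ∑' m : ℕ, genC t (2 * (m + 1)) / ((2 * (m + 1) : ℕ) * (K - 1) + 1))

/-- `A(t,K) = 1 + ∑_{n even, n≥2} D(t,n)/(n(K−1)+1) − ∑_{n odd, n≥1} D(t,n)/((n+1)(K−1)+1)`. -/
noncomputable def Afun (t K : ℝ) : ℝ :=
  1 + (∑' m : ℕ, genD t (2 * (m + 1)) / ((2 * (m + 1) : ℕ) * (K - 1) + 1))
    - ∑' m : ℕ, genD t (2 * m + 1) / (((2 * m + 1 : ℕ) + 1) * (K - 1) + 1)

/-- `H2(t;0,K) = −K·log A(t,K)`. -/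
noncomputable def H2zero (t K : ℝ) : ℝ := -K * Real.log (Afun t K)

theorem genD_succ (t : ℝ) (n : ℕ) : genD t (n + 1) = genD t n * ((t + n) / (n + 1)) := by
  have h : (n.factorial : ℝ) ≠ 0 := by positivity
  simp only [genD, Finset.prod_range_succ, Nat.factorial_succ]
  push_cast
  field_simp

theorem genC_succ (t : ℝ) (n : ℕ) : genC t (n + 1) = genC t n * ((t - n) / (n + 1)) := by
  have h : (n.factorial : ℝ) ≠ 0 := by positivity
  simp only [genC, Finset.prod_range_succ, Nat.factorial_succ]
  push_cast
  field_simp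

theorem genD_nonneg {t : ℝ} (ht : 0 ≤ t) (n : ℕ) : 0 ≤ genD t n := by
  unfold genD
  positivity

theorem genD_sub_genD_succ (t : ℝ) (n : ℕ) :
    genD t n - genD t (n + 1) = (1 - t) * (genD t n / (n + 1)) := by
  rw [genD_succ]
  field_simp
  ring

theorem genD_antitone {t : ℝ} (ht0 : 0 ≤ t) (ht1 : t ≤ 1) : Antitone (genD t) := by
  refine antitone_nat_of_succ_le fun n ↦ ?_
  have h := genD_sub_genD_succ t n
  have h' : 0 ≤ (1 - t) * (genD t n / (n + 1)) :=
    mul_nonneg (by linarith) (div_nonneg (genD_nonneg ht0 n) (by positivity))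
  linarith

theorem genC_one_sub (s : ℝ) (n : ℕ) :
    genC (1 - s) (n + 1) = (-1) ^ n * (genD s n - genD s (n + 1)) := by
  induction n with
  | zero => simp [genC, genD]
  | succ n ih =>
    rw [genC_succ, ih, genD_sub_genD_succ, genD_sub_genD_succ, genD_succ]
    push_cast
    field_simp
    ring

theorem summable_genD_div {t : ℝ} (ht0 : 0 ≤ t) (ht1 : t < 1) :
    Summable fun n : ℕ ↦ genD t n / (n + 1) := by
  have h : Summable fun n : ℕ ↦ genD t n - genD t (n + 1) := by
    refine summable_of_sum_range_le (c := genD t 0) (fun n ↦ ?_) fun n ↦ ?_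
    · exact sub_nonneg.2 (genD_antitone ht0 ht1.le n.le_succ)
    · rw [Finset.sum_range_sub']
      linarith [genD_nonneg ht0 n]
  simp_rw [genD_sub_genD_succ] at h
  exact (summable_mul_left_iff (by linarith : 1 - t ≠ 0)).1 h

/-- The common deficit `1 - A(s,K)`, which is also the deficit of the false-positive series at
`t = 1 - s`. -/
noncomputable def deficit (s K : ℝ) : ℝ :=
  ∑' m : ℕ, (genD s (2 * m + 1) - genD s (2 * m + 2)) / ((2 * m + 2) * (K - 1) + 1)

theorem one_add_tsum_genC (s K : ℝ) :
    1 + ∑' m : ℕ, genC (1 - s) (2 * (m + 1)) / ((2 * (m + 1) : ℕ) * (K - 1) + 1)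
      = 1 - deficit s K := by
  rw [deficit, sub_eq_add_neg 1 (∑' _, _), ← tsum_neg]
  congr 2 with m
  rw [show 2 * (m + 1) = 2 * m + 1 + 1 by ring, genC_one_sub, pow_succ, pow_mul]
  push_cast
  ring

theorem Afun_eq {s K : ℝ} (hs0 : 0 ≤ s) (hs1 : s < 1) (hK : 2 ≤ K) :
    Afun s K = 1 - deficit s K := by
  have hsum := summable_genD_div hs0 hs1
  have heven : Summable fun m : ℕ ↦
      genD s (2 * (m + 1)) / ((2 * (m + 1) : ℕ) * (K - 1) + 1) := by
    refine (hsum.comp_injective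
      (i := fun m : ℕ ↦ 2 * (m + 1)) (fun a b h ↦ by simpa using h)).of_nonneg_of_le
      (fun m ↦ ?_) fun m ↦ ?_
    · have := genD_nonneg hs0 (2 * (m + 1))
      have : 0 ≤ K - 1 := by linarith
      positivity
    · refine div_le_div_of_nonneg_left (genD_nonneg hs0 _) (by positivity) ?_
      have : (0 : ℝ) ≤ (2 * (m + 1) : ℕ) := by positivity
      nlinarith
  have hodd : Summable fun m : ℕ ↦
      genD s (2 * m + 1) / (((2 * m + 1 : ℕ) + 1) * (K - 1) + 1) := by
    refine (hsum.comp_injective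
      (i := fun m : ℕ ↦ 2 * m + 1) (fun a b h ↦ by simpa using h)).of_nonneg_of_le
      (fun m ↦ ?_) fun m ↦ ?_
    · have := genD_nonneg hs0 (2 * m + 1)
      have : 0 ≤ K - 1 := by linarith
      positivity
    · refine div_le_div_of_nonneg_left (genD_nonneg hs0 _) (by positivity) ?_
      have : (0 : ℝ) ≤ (2 * m + 1 : ℕ) := by positivity
      nlinarith
  rw [Afun, add_sub_assoc, ← heven.tsum_sub hodd, deficit, sub_eq_add_neg 1, ← tsum_neg]
  congr 2 with m
  rw [show 2 * (m + 1) = 2 * m + 2 by ring]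
  push_cast
  ring

theorem deficit_term_nonneg {s K : ℝ} (hs0 : 0 ≤ s) (hs1 : s < 1) (hK : 2 ≤ K) (m : ℕ) :
    0 ≤ (genD s (2 * m + 1) - genD s (2 * m + 2)) / ((2 * m + 2) * (K - 1) + 1) := by
  have : 0 ≤ K - 1 := by linarith
  exact div_nonneg (sub_nonneg.2 (genD_antitone hs0 hs1.le (by lia))) (by positivity)

theorem sum_deficit_le {s K : ℝ} (hs0 : 0 ≤ s) (hs1 : s < 1) (hK : 2 ≤ K) (n : ℕ) :
    ∑ m ∈ Finset.range n,
      (genD s (2 * m + 1) - genD s (2 * m + 2)) / ((2 * m + 2) * (K - 1) + 1) ≤ s := by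
  have hanti := genD_antitone hs0 hs1.le
  calc
    _ ≤ ∑ m ∈ Finset.range n, (genD s (2 * m + 1) - genD s (2 * (m + 1) + 1)) := by
      refine Finset.sum_le_sum fun m _ ↦ ?_
      have h1 : genD s (2 * m + 2) ≤ genD s (2 * m + 1) := hanti (by lia)
      have h2 : genD s (2 * (m + 1) + 1) ≤ genD s (2 * m + 2) := hanti (by lia)
      refine (div_le_self (sub_nonneg.2 h1) ?_).trans (by linarith)
      have : 0 ≤ K - 1 := by linarith
      have : 0 ≤ (2 * (m : ℝ) + 2) * (K - 1) := by positivity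
      linarith
    _ = genD s 1 - genD s (2 * n + 1) :=
      Finset.sum_range_sub' (fun m ↦ genD s (2 * m + 1)) n
    _ ≤ s := by
      have : genD s 1 = s := by simp [genD]
      linarith [genD_nonneg hs0 (2 * n + 1)]

theorem deficit_le {s K : ℝ} (hs0 : 0 ≤ s) (hs1 : s < 1) (hK : 2 ≤ K) : deficit s K ≤ s :=
  Real.tsum_le_of_sum_range_le (deficit_term_nonneg hs0 hs1 hK) (sum_deficit_le hs0 hs1 hK)

theorem sum_le_mul_deficit {s K : ℝ} (hs0 : 0 ≤ s) (hs1 : s < 1) (hK : 2 ≤ K) (n : ℕ) :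
    ∑ m ∈ Finset.range n, (1 - s) * genD s (2 * m + 1) / (2 * m + 2) ^ 2
      ≤ K * deficit s K := by
  have hterm := deficit_term_nonneg hs0 hs1 hK
  have hsum := summable_of_sum_range_le hterm (sum_deficit_le hs0 hs1 hK)
  calc
    _ ≤ ∑ m ∈ Finset.range n,
        K * ((genD s (2 * m + 1) - genD s (2 * m + 2)) / ((2 * m + 2) * (K - 1) + 1)) := by
      refine Finset.sum_le_sum fun m _ ↦ ?_
      have hK1 : 0 ≤ K - 1 := by linarith
      have hs : 0 ≤ 1 - s := by linarith
      have hD := genD_nonneg hs0 (2 * m + 1)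
      rw [genD_sub_genD_succ]
      push_cast
      rw [show (2 * (m : ℝ) + 1 + 1) = 2 * m + 2 by ring, ← mul_div_assoc, ← mul_div_assoc,
        ← mul_div_assoc, div_div, div_le_div_iff₀ (by positivity) (by positivity)]
      have : (2 * (m : ℝ) + 2) * (K - 1) + 1 ≤ K * (2 * m + 2) := by
        have : (0 : ℝ) ≤ m := by positivity
        linarith
      calc (1 - s) * genD s (2 * m + 1) * ((2 * m + 2) * ((2 * m + 2) * (K - 1) + 1))
          ≤ (1 - s) * genD s (2 * m + 1) * ((2 * m + 2) * (K * (2 * m + 2))) := by gcongr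
        _ = _ := by ring
    _ ≤ K * deficit s K := by
      rw [← Finset.mul_sum]
      exact mul_le_mul_of_nonneg_left (hsum.sum_le_tsum _ fun m _ ↦ hterm m) (by linarith)

/-- The rational values `D(11/20, 2m+1)`, computed recursively. -/
def ratGenDOdd : ℕ → ℚ
  | 0 => 11 / 20
  | m + 1 => ratGenDOdd m *
      (((11 / 20 + (2 * m + 1)) / (2 * m + 2)) * ((11 / 20 + (2 * m + 2)) / (2 * m + 3)))

theorem genD_eq_ratGenDOdd (m : ℕ) : genD (11 / 20) (2 * m + 1) = ratGenDOdd m := by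
  induction m with
  | zero => simp [genD, ratGenDOdd]
  | succ m ih =>
    rw [show 2 * (m + 1) + 1 = 2 * m + 1 + 1 + 1 by ring, genD_succ, genD_succ, ih, ratGenDOdd]
    push_cast
    ring

theorem inv_le_sum_genD :
    1 / 12.3 ≤ ∑ m ∈ Finset.range 35,
      (1 - 11 / 20) * genD (11 / 20) (2 * m + 1) / (2 * (m : ℝ) + 2) ^ 2 := by
  have h : (10 / 123 : ℚ) ≤ ∑ m ∈ Finset.range 35,
      (1 - 11 / 20) * ratGenDOdd m / (2 * (m : ℚ) + 2) ^ 2 := by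
    decide +kernel
  have h' := (Rat.cast_le (K := ℝ)).2 h
  push_cast at h'
  simp_rw [genD_eq_ratGenDOdd]
  exact le_trans (by norm_num) h'

theorem exp_mul_log_one_sub_le {K L M d : ℝ} (hK : 0 < K) (hL : 0 ≤ L) (hd : d < 1)
    (hKd : 1 / 12.3 ≤ K * d) (hM : 12.3 * K * L ≤ M) :
    Real.exp (-(M / K) * (-K * Real.log (1 - d))) ≤ Real.exp (-L) := by
  have hM0 : 0 ≤ M := le_trans (by positivity) hM
  have hlog : Real.log (1 - d) ≤ -d := by
    linarith [Real.log_le_sub_one_of_pos (sub_pos.2 hd)]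
  have hd0 : 0 ≤ d := le_of_mul_le_mul_left (by linarith) hK
  rw [Real.exp_le_exp, show -(M / K) * (-K * Real.log (1 - d)) = M * Real.log (1 - d) by field_simp]
  calc M * Real.log (1 - d) ≤ M * -d := by gcongr
    _ ≤ -(12.3 * K * L * d) := by nlinarith
    _ ≤ -L := by nlinarith

/-- **Quantitative core of Theorem 1.**  For integers `N > K ≥ 2`, `δ ∈ (0,1)` and a real
`M ≥ 12.3·K·log(N/δ)`, there exist `t₁, t₂ ∈ (0,1)` with
`(N−K)·exp(−(M/K)·H1(t₁;0,K)) + K·exp(−(M/K)·H2(t₂;0,K)) ≤ δ`. -/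
theorem sample_complexity_union_bound
    (N K : ℕ) (hKN : K < N) (hK : 2 ≤ K) (δ : ℝ) (hδ0 : 0 < δ) (hδ1 : δ < 1)
    (M : ℝ) (hM : 12.3 * K * Real.log (N / δ) ≤ M) :
    ∃ t₁ t₂ : ℝ, 0 < t₁ ∧ t₁ < 1 ∧ 0 < t₂ ∧ t₂ < 1 ∧
      (N - K : ℝ) * Real.exp (-(M / K) * H1zero t₁ K)
        + (K : ℝ) * Real.exp (-(M / K) * H2zero t₂ K) ≤ δ := by
  have hK2 : (2 : ℝ) ≤ K := by exact_mod_cast hK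
  have hKN' : (K : ℝ) < N := by exact_mod_cast hKN
  have hN : (0 : ℝ) < N := by linarith
  have hL : 0 ≤ Real.log (N / δ) := Real.log_nonneg ((one_le_div hδ0).2 (by linarith))
  have hs1 : (11 / 20 : ℝ) < 1 := by norm_num
  have hbound := exp_mul_log_one_sub_le (d := deficit (11 / 20) K) (by linarith) hL
    ((deficit_le (by norm_num) hs1 hK2).trans_lt hs1)
    (inv_le_sum_genD.trans (sum_le_mul_deficit (by norm_num) hs1 hK2 35)) hM
  rw [← Real.log_inv, inv_div, Real.exp_log (by positivity)] at hbound
  refine ⟨1 - 11 / 20, 11 / 20, by norm_num, by norm_num, by norm_num, by norm_num, ?_⟩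
  rw [H1zero, H2zero, one_add_tsum_genC, Afun_eq (by norm_num) hs1 hK2]
  calc _ ≤ (N - K : ℝ) * (δ / N) + K * (δ / N) := by
        have : (0 : ℝ) ≤ N - K := by linarith
        gcongr
    _ = δ := by field_simp; ring
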